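/- Let G be a finite simple graph and let T₁,…,T_k (k ≥ 1) be pairwise disjoint nonempty subsets of V(G) with T₁ ∪ … ∪ T_k = V(G), such that for all i ≠ j, every vertex of T_i has at least |T_j|/2 neighbours in T_j, and assume at least one Steiner forest for (G; T₁,…,T_k) exists. Then there exists a minimum Steiner forest with at most one connected component of rank greater than 3. -/

import Mathlib

/-- A Steiner forest for `(G; T₁, …, T_k)`: a subgraph of `G` that is a forest (acyclic) in
which, for each `i`, all vertices of `T i` lie in the same connected component. -/
def IsSteinerForest {V : Type*} (G : SimpleGraph V) {k : ℕ} (T : Fin k → Finset V)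
    (F : SimpleGraph V) : Prop :=
  F ≤ G ∧ F.IsAcyclic ∧ ∀ i : Fin k, ∀ u ∈ T i, ∀ v ∈ T i, F.Reachable u v

/-- The rank of a connected component `C` of a forest `F`: the number of indices `i` such
that `C` contains a vertex of `T i`. -/
noncomputable def compRank {V : Type*} {k : ℕ} (T : Fin k → Finset V) (F : SimpleGraph V)
    (C : F.ConnectedComponent) : ℕ :=
  {i : Fin k | ∃ v ∈ T i, F.connectedComponentMk v = C}.ncard

namespace SimpleGraph

variable {V ι : Type*}

theorem Reachable.induction_on {G : SimpleGraph V} {P : V → Prop} {a b : V}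
    (h : G.Reachable a b) (ha : P a) (hstep : ∀ u v, P u → G.Adj u v → P v) : P b := by
  rw [reachable_iff_reflTransGen] at h
  induction h with
  | refl => exact ha
  | tail _ hadj ih => exact hstep _ _ ih hadj

theorem Reachable.deleteEdges_cases {F : SimpleGraph V} {u v a b : V} (h : F.Reachable a b) :
    (F.deleteEdges {s(u, v)}).Reachable a b ∨
      ((F.deleteEdges {s(u, v)}).Reachable a u ∧ (F.deleteEdges {s(u, v)}).Reachable b v) ∨
      ((F.deleteEdges {s(u, v)}).Reachable a v ∧ (F.deleteEdges {s(u, v)}).Reachable b u) := by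
  refine h.induction_on (P := fun b => (F.deleteEdges {s(u, v)}).Reachable a b ∨
      ((F.deleteEdges {s(u, v)}).Reachable a u ∧ (F.deleteEdges {s(u, v)}).Reachable b v) ∨
      ((F.deleteEdges {s(u, v)}).Reachable a v ∧ (F.deleteEdges {s(u, v)}).Reachable b u))
    (Or.inl .rfl) fun x y ih hxy => ?_
  by_cases he : s(x, y) = s(u, v)
  · rw [Sym2.eq_iff] at he
    obtain ⟨rfl, rfl⟩ | ⟨rfl, rfl⟩ := he
    · obtain h | h | h := ih
      · exact Or.inr (Or.inl ⟨h, .rfl⟩)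
      · exact Or.inr (Or.inl ⟨h.1, .rfl⟩)
      · exact Or.inl h.1
    · obtain h | h | h := ih
      · exact Or.inr (Or.inr ⟨h, .rfl⟩)
      · exact Or.inl h.1
      · exact Or.inr (Or.inr ⟨h.1, .rfl⟩)
  · have hyx : (F.deleteEdges {s(u, v)}).Reachable y x :=
      Adj.reachable ((deleteEdges_adj).2 ⟨hxy, he⟩ : (F.deleteEdges {s(u, v)}).Adj x y).symm
    obtain h | h | h := ih
    · exact Or.inl (h.trans hyx.symm)
    · exact Or.inr (Or.inl ⟨h.1, hyx.trans h.2⟩)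
    · exact Or.inr (Or.inr ⟨h.1, hyx.trans h.2⟩)

theorem card_connectedComponent_deleteEdges [Finite V] {F : SimpleGraph V} {u v : V}
    (huv : F.Adj u v) (hb : ¬ (F.deleteEdges {s(u, v)}).Reachable u v) :
    Nat.card (F.deleteEdges {s(u, v)}).ConnectedComponent =
      Nat.card F.ConnectedComponent + 1 := by
  classical
  set F' := F.deleteEdges {s(u, v)}
  have hle : F' ≤ F := deleteEdges_le _
  let q : {C : F'.ConnectedComponent // C ≠ F'.connectedComponentMk u} → F.ConnectedComponent :=
    fun C => C.1.map (Hom.ofLE hle)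
  have hq : Function.Bijective q := by
    constructor
    · rintro ⟨C, hC⟩ ⟨D, hD⟩ h
      induction C using ConnectedComponent.ind with | _ a
      induction D using ConnectedComponent.ind with | _ b
      have hab : F.Reachable a b := ConnectedComponent.exact h
      rw [Ne, ConnectedComponent.eq] at hC hD
      obtain h | h | h := hab.deleteEdges_cases (u := u) (v := v)
      · exact Subtype.ext (ConnectedComponent.sound h)
      · exact absurd h.1 hC
      · exact absurd h.2 hD
    · intro C
      induction C using ConnectedComponent.ind with | _ a
      by_cases ha : F'.Reachable a u
      · refine ⟨⟨F'.connectedComponentMk v, fun h => hb (ConnectedComponent.exact h).symm⟩, ?_⟩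
        exact ConnectedComponent.sound (huv.symm.reachable.trans (ha.mono hle).symm)
      · exact ⟨⟨F'.connectedComponentMk a, fun h => ha (ConnectedComponent.exact h)⟩, rfl⟩
  rw [← Nat.card_congr (Equiv.ofBijective q hq)]
  have := Nat.card_congr (Equiv.sumCompl fun C => C = F'.connectedComponentMk u)
  rw [Nat.card_sum, Nat.card_unique] at this
  rw [← this, add_comm]

theorem IsAcyclic.ncard_edgeSet_add_card_connectedComponent [Finite V] {F : SimpleGraph V}
    (hF : F.IsAcyclic) : F.edgeSet.ncard + Nat.card F.ConnectedComponent = Nat.card V := by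
  induction hn : F.edgeSet.ncard generalizing F with
  | zero =>
    rw [Set.ncard_eq_zero, edgeSet_eq_empty] at hn
    subst hn
    rw [zero_add]
    refine (Nat.card_congr (Equiv.ofBijective (connectedComponentMk ⊥) ⟨fun a b h => ?_, ?_⟩)).symm
    · simpa using ConnectedComponent.exact h
    · exact Quot.mk_surjective
  | succ n ih =>
    obtain ⟨e, he⟩ := Set.nonempty_of_ncard_ne_zero (s := F.edgeSet) (by lia)
    induction e using Sym2.ind with | _ u v
    have hbr := isAcyclic_iff_forall_adj_isBridge.1 hF he
    have hcard := card_connectedComponent_deleteEdges he (isBridge_iff.1 hbr)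
    have hdel : (F.deleteEdges {s(u, v)}).edgeSet.ncard = n := by
      rw [edgeSet_deleteEdges, Set.ncard_sdiff_singleton_of_mem he, hn, Nat.add_sub_cancel]
    have := ih (hF.anti (deleteEdges_le _)) hdel
    lia

/-- The subgraph of `G` formed by the edges with both ends indexed by `S`. -/
def inIndices (G : SimpleGraph V) (idx : V → ι) (S : Set ι) : SimpleGraph V where
  Adj u v := G.Adj u v ∧ idx u ∈ S ∧ idx v ∈ S
  symm := ⟨fun _ _ h => ⟨h.1.symm, h.2.2, h.2.1⟩⟩
  loopless := ⟨fun _ h => G.loopless.irrefl _ h.1⟩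

/-- The vertices indexed by `S` induce a preconnected subgraph of `G`. -/
def IndexConnected (G : SimpleGraph V) (idx : V → ι) (S : Set ι) : Prop :=
  ∀ u v, idx u ∈ S → idx v ∈ S → (G.inIndices idx S).Reachable u v

/-- Each vertex outside the class `j` is adjacent to at least half of this class. -/
def HalfDense (G : SimpleGraph V) (idx : V → ι) : Prop :=
  ∀ v j, idx v ≠ j → {w | idx w = j}.ncard ≤ 2 * {w | idx w = j ∧ G.Adj v w}.ncard

variable {G : SimpleGraph V} {idx : V → ι} {S S' : Set ι}

theorem inIndices_mono (h : S ⊆ S') : G.inIndices idx S ≤ G.inIndices idx S' :=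
  fun _ _ huv => ⟨huv.1, h huv.2.1, h huv.2.2⟩

theorem Reachable.inIndices_mem {u v : V} (h : (G.inIndices idx S).Reachable u v)
    (hu : idx u ∈ S) : idx v ∈ S :=
  h.induction_on hu fun _ _ _ h => h.2.2

section Finite

variable [Finite V]

theorem HalfDense.exists_adj (hG : G.HalfDense idx) (hidx : Function.Surjective idx) {v : V} {j : ι}
    (h : idx v ≠ j) : ∃ w, idx w = j ∧ G.Adj v w := by
  have h1 := hG v j h
  obtain ⟨w, hw⟩ := hidx j
  have h2 : 0 < {w | idx w = j}.ncard := (Set.ncard_pos).2 ⟨w, hw⟩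
  exact (Set.ncard_pos).1 (by lia : 0 < {w | idx w = j ∧ G.Adj v w}.ncard)

theorem IndexConnected.mono (hG : G.HalfDense idx) (hidx : Function.Surjective idx)
    (hS : G.IndexConnected idx S) (hne : S.Nonempty) (hsub : S ⊆ S') :
    G.IndexConnected idx S' := by
  have key : ∀ v, idx v ∈ S' → ∃ w, idx w ∈ S ∧ (G.inIndices idx S').Reachable v w := by
    intro v hv
    by_cases hvS : idx v ∈ S
    · exact ⟨v, hvS, .rfl⟩
    · obtain ⟨i, hi⟩ := hne
      obtain ⟨w, rfl, hvw⟩ := hG.exists_adj hidx (v := v) (j := i) (fun h => hvS (h ▸ hi))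
      exact ⟨w, hi, Adj.reachable ⟨hvw, hv, hsub hi⟩⟩
  intro u v hu hv
  obtain ⟨u', hu', huu'⟩ := key u hu
  obtain ⟨v', hv', hvv'⟩ := key v hv
  exact huu'.trans (((hS u' v' hu' hv').mono (inIndices_mono hsub)).trans hvv'.symm)

theorem HalfDense.le_two_mul_ncard_reachable (hG : G.HalfDense idx)
    (hidx : Function.Surjective idx) (hS : S.Nontrivial) {x : V} (hx : idx x ∈ S) {i : ι}
    (hi : i ∈ S) : {w | idx w = i}.ncard ≤
      2 * {w | idx w = i ∧ (G.inIndices idx S).Reachable x w}.ncard := by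
  have key : ∀ y, (G.inIndices idx S).Reachable x y → idx y ≠ i →
      {w | idx w = i}.ncard ≤
        2 * {w | idx w = i ∧ (G.inIndices idx S).Reachable x w}.ncard := by
    intro y hxy hy
    refine (hG y i hy).trans (Nat.mul_le_mul_left 2 (Set.ncard_le_ncard ?_))
    rintro w ⟨rfl, hw⟩
    exact ⟨rfl, hxy.trans (Adj.reachable ⟨hw, hxy.inIndices_mem hx, hi⟩)⟩
  by_cases hxi : idx x = i
  · obtain ⟨j, hj, hji⟩ := hS.exists_ne i
    obtain ⟨y, rfl, hxy⟩ := hG.exists_adj hidx (v := x) (j := j) (fun h => hji (h ▸ hxi))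
    exact key y (Adj.reachable ⟨hxy, hx, hj⟩) hji
  · exact key x .rfl hxi

theorem HalfDense.two_mul_ncard_reachable (hG : G.HalfDense idx)
    (hidx : Function.Surjective idx) (hS : S.Nontrivial) (hbad : ¬ G.IndexConnected idx S)
    {x : V} (hx : idx x ∈ S) {i : ι} (hi : i ∈ S) :
    2 * {w | idx w = i ∧ (G.inIndices idx S).Reachable x w}.ncard = {w | idx w = i}.ncard := by
  refine le_antisymm ?_ (hG.le_two_mul_ncard_reachable hidx hS hx hi)
  obtain ⟨y, hy, hxy⟩ : ∃ y, idx y ∈ S ∧ ¬ (G.inIndices idx S).Reachable x y := by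
    by_contra! h
    exact hbad fun u v hu hv => (h u hu).symm.trans (h v hv)
  have hdisj : Disjoint {w | idx w = i ∧ (G.inIndices idx S).Reachable x w}
      {w | idx w = i ∧ (G.inIndices idx S).Reachable y w} :=
    Set.disjoint_left.2 fun w hw hw' => hxy (hw.2.trans hw'.2.symm)
  have h1 := hG.le_two_mul_ncard_reachable hidx hS hy hi
  have h2 := Set.ncard_union_eq hdisj
  have h3 : ({w | idx w = i ∧ (G.inIndices idx S).Reachable x w} ∪
      {w | idx w = i ∧ (G.inIndices idx S).Reachable y w}).ncard ≤ {w | idx w = i}.ncard :=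
    Set.ncard_le_ncard (Set.union_subset (fun _ h => h.1) fun _ h => h.1)
  lia

theorem HalfDense.reachable_iff_of_subset (hG : G.HalfDense idx)
    (hidx : Function.Surjective idx) (hS : S.Nontrivial) (hsub : S ⊆ S')
    (hbad : ¬ G.IndexConnected idx S') {x v : V} (hx : idx x ∈ S) (hv : idx v ∈ S) :
    (G.inIndices idx S').Reachable x v ↔ (G.inIndices idx S).Reachable x v := by
  have hbad' : ¬ G.IndexConnected idx S := fun h => hbad (h.mono hG hidx hS.nonempty hsub)
  have h1 := hG.two_mul_ncard_reachable hidx hS hbad' hx hv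
  have h2 := hG.two_mul_ncard_reachable hidx (hS.mono hsub) hbad (hsub hx) (hsub hv)
  have heq := Set.eq_of_subset_of_ncard_le
    (s := {w | idx w = idx v ∧ (G.inIndices idx S).Reachable x w})
    (t := {w | idx w = idx v ∧ (G.inIndices idx S').Reachable x w})
    (fun w hw => ⟨hw.1, hw.2.mono (inIndices_mono hsub)⟩) (by lia)
  have := Set.ext_iff.1 heq v
  simpa using this.symm

theorem IndexConnected.exists_subset_ncard_le_three (hG : G.HalfDense idx)
    (hidx : Function.Surjective idx) (hS : G.IndexConnected idx S) (hnt : S.Nontrivial) :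
    ∃ J ⊆ S, J.Nonempty ∧ J.ncard ≤ 3 ∧ G.IndexConnected idx J := by
  by_contra! hbad
  have hbad3 : ∀ a ∈ S, ∀ b ∈ S, ∀ c ∈ S, ¬ G.IndexConnected idx {a, b, c} := by
    intro a ha b hb c hc
    refine hbad _ (by simp [Set.insert_subset_iff, ha, hb, hc]) (by simp) ?_
    exact (Set.ncard_insert_le _ _).trans
      (Nat.succ_le_succ ((Set.ncard_insert_le _ _).trans (by simp)))
  obtain ⟨a, ha, b, hb, hab⟩ := hnt
  obtain ⟨x, rfl⟩ := hidx a
  have hpair : ∀ c ∈ S, ∀ d ∈ S, idx x ≠ c → ∀ v, idx v = idx x ∨ idx v = c →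
      ((G.inIndices idx {idx x, c, d}).Reachable x v ↔
        (G.inIndices idx {idx x, c}).Reachable x v) := by
    intro c hc d hd hne v hv
    refine hG.reachable_iff_of_subset hidx (Set.nontrivial_pair hne) ?_
      (hbad3 _ ha c hc d hd) (by simp) (by simpa using hv)
    grind
  have hswap : ∀ c d, ({idx x, c, d} : Set ι) = {idx x, d, c} := by grind
  have hclosed : ∀ v, (G.inIndices idx S).Reachable x v →
      idx v ∈ S ∧ (G.inIndices idx {idx x, b, idx v}).Reachable x v := by
    intro v hv
    refine hv.induction_on (P := fun v => idx v ∈ S ∧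
      (G.inIndices idx {idx x, b, idx v}).Reachable x v) ⟨ha, .rfl⟩ ?_
    rintro u v ⟨hu, hxu⟩ ⟨huv, -, hvS⟩
    refine ⟨hvS, ?_⟩
    by_cases hux : idx u = idx x
    · rw [hpair b hb _ hu hab u (Or.inl hux), ← hpair b hb _ hvS hab u (Or.inl hux)] at hxu
      exact hxu.trans (Adj.reachable ⟨huv, by simp [hux], by simp⟩)
    by_cases hvx : idx v = idx x
    · have : (G.inIndices idx {idx x, b, idx u}).Reachable x v :=
        hxu.trans (Adj.reachable ⟨huv, by simp, by simp [hvx]⟩)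
      rwa [hpair b hb _ hu hab v (Or.inl hvx), ← hpair b hb _ hvS hab v (Or.inl hvx)] at this
    · rw [hswap, hpair _ hu b hb (Ne.symm hux) u (Or.inr rfl),
        ← hpair _ hu _ hvS (Ne.symm hux) u (Or.inr rfl)] at hxu
      have : (G.inIndices idx {idx x, idx u, idx v}).Reachable x v :=
        hxu.trans (Adj.reachable ⟨huv, by simp, by simp⟩)
      rwa [hswap, hpair _ hvS _ hu (Ne.symm hvx) v (Or.inr rfl),
        ← hpair _ hvS b hb (Ne.symm hvx) v (Or.inr rfl), hswap] at this
  have hall : ∀ v, idx v = idx x ∨ idx v = b →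
      (G.inIndices idx {idx x, b}).Reachable x v := by
    intro v hv
    have hvS : idx v ∈ S := by grind
    exact (hpair b hb _ hvS hab v hv).1 (hclosed v (hS x v ha hvS)).2
  refine hbad {idx x, b} (by grind) (by simp) ((Set.ncard_insert_le _ _).trans (by simp)) ?_
  exact fun u v hu hv => (hall u hu).symm.trans (hall v hv)

end Finite

/-- A labelling of the indices with connected fibres is realised by the components of a
spanning forest. -/
theorem exists_isAcyclic_of_indexConnected_fibers {K : Type*} (f : ι → K)
    (hf : ∀ C, G.IndexConnected idx (f ⁻¹' {C})) :
    ∃ F ≤ G, F.IsAcyclic ∧ ∀ u v, F.Reachable u v ↔ f (idx u) = f (idx v) := by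
  let H : SimpleGraph V :=
    { Adj := fun u v => G.Adj u v ∧ f (idx u) = f (idx v)
      symm := ⟨fun _ _ h => ⟨h.1.symm, h.2.symm⟩⟩
      loopless := ⟨fun _ h => G.loopless.irrefl _ h.1⟩ }
  obtain ⟨F, hFH, hF, hreach⟩ := H.exists_isAcyclic_reachable_eq_le
  refine ⟨F, fun _ _ h => (hFH h).1, hF, fun u v => ?_⟩
  rw [hreach]
  constructor
  · intro h
    exact h.induction_on (P := fun v => f (idx u) = f (idx v)) rfl fun _ _ h1 h2 => h1.trans h2.2
  · intro h
    refine (hf (f (idx v)) u v h rfl).mono fun a b (hab : (G.inIndices idx _).Adj a b) => ⟨hab.1, ?_⟩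
    exact (hab.2.1 : f (idx a) = _).trans (hab.2.2 : f (idx b) = _).symm

theorem indexConnected_fiber {F : SimpleGraph V} (hFG : F ≤ G) (L : ι → F.ConnectedComponent)
    (hL : ∀ v, F.connectedComponentMk v = L (idx v)) (C : F.ConnectedComponent) :
    G.IndexConnected idx (L ⁻¹' {C}) := by
  intro u v hu hv
  have huv : F.Reachable u v := by
    refine ConnectedComponent.exact ?_
    rw [hL, hL]
    exact (hu : L (idx u) = C).trans (hv : L (idx v) = C).symm
  refine (huv.induction_on (P := fun w => L (idx w) = C ∧
    (G.inIndices idx (L ⁻¹' {C})).Reachable u w) ⟨hu, .rfl⟩ ?_).2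
  rintro a b ⟨ha, hra⟩ hab
  have hb : L (idx b) = C := by
    rw [← ha, ← hL, ← hL]
    exact ConnectedComponent.sound hab.symm.reachable
  exact ⟨hb, hra.trans (Adj.reachable ⟨hFG hab, ha, hb⟩)⟩

end SimpleGraph

section SteinerForest

open SimpleGraph

variable {V : Type*} {G F : SimpleGraph V} {k : ℕ} {T : Fin k → Finset V}
  {idx : V → Fin k}

theorem compRank_eq_ncard_fiber {K : Type*} {f : Fin k → K} (hT : ∀ v i, v ∈ T i ↔ idx v = i)
    (hidx : Function.Surjective idx)
    (hf : ∀ u v, F.Reachable u v ↔ f (idx u) = f (idx v)) (v : V) :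
    compRank T F (F.connectedComponentMk v) = (f ⁻¹' {f (idx v)}).ncard := by
  unfold compRank
  congr 1
  ext i
  simp only [hT, Set.mem_ofPred_eq, Set.mem_preimage, Set.mem_singleton_iff, ConnectedComponent.eq,
    hf]
  constructor
  · rintro ⟨u, rfl, h⟩
    exact h
  · obtain ⟨u, rfl⟩ := hidx i
    exact fun h => ⟨u, rfl, h⟩

/-- Two components of rank greater than three can be rearranged so that only one remains. -/
theorem IsSteinerForest.exists_fewer_high_rank [Finite V] (hG : G.HalfDense idx)
    (hT : ∀ v i, v ∈ T i ↔ idx v = i) (hidx : Function.Surjective idx)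
    (hF : IsSteinerForest G T F) {C₁ C₂ : F.ConnectedComponent} (hne : C₁ ≠ C₂)
    (h₁ : 3 < compRank T F C₁) (h₂ : 3 < compRank T F C₂) :
    ∃ F', IsSteinerForest G T F' ∧ F'.edgeSet.ncard = F.edgeSet.ncard ∧
      {C | 3 < compRank T F' C}.ncard < {C | 3 < compRank T F C}.ncard := by
  classical
  let L : Fin k → F.ConnectedComponent :=
    fun i => F.connectedComponentMk (Function.surjInv hidx i)
  have hL : ∀ v, F.connectedComponentMk v = L (idx v) := fun v =>
    ConnectedComponent.sound (hF.2.2 (idx v) _ ((hT _ _).2 rfl) _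
      ((hT _ _).2 (Function.surjInv_eq hidx _)))
  have hLreach : ∀ u v, F.Reachable u v ↔ L (idx u) = L (idx v) := fun u v => by
    rw [← hL, ← hL, ConnectedComponent.eq]
  have hLsurj : Function.Surjective L := by
    intro C
    induction C using ConnectedComponent.ind with | _ v
    exact ⟨idx v, (hL v).symm⟩
  have hrank : ∀ C, compRank T F C = (L ⁻¹' {C}).ncard := by
    intro C
    induction C using ConnectedComponent.ind with | _ v
    rw [compRank_eq_ncard_fiber hT hidx hLreach, hL]
  have hconn := indexConnected_fiber hF.1 L hL
  rw [hrank] at h₁ h₂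
  obtain ⟨J, hJ, hJne, hJcard, hJconn⟩ := (hconn C₂).exists_subset_ncard_le_three hG hidx
    ((Set.one_lt_ncard_iff_nontrivial).1 (by lia))
  have hJL : ∀ i ∈ J, L i = C₂ := fun i hi => hJ hi
  let f : Fin k → F.ConnectedComponent :=
    fun i => if i ∈ J then C₂ else if L i = C₂ then C₁ else L i
  have hf₁ : L ⁻¹' {C₁} ⊆ f ⁻¹' {C₁} := by
    intro i (hi : L i = C₁)
    change f i = C₁
    grind
  have hf₂ : f ⁻¹' {C₂} = J := by
    ext i
    change f i = C₂ ↔ _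
    grind
  have hf₃ : ∀ C, C ≠ C₁ → C ≠ C₂ → f ⁻¹' {C} = L ⁻¹' {C} := by
    intro C hC₁ hC₂
    ext i
    change f i = C ↔ L i = C
    grind
  have hfconn : ∀ C, G.IndexConnected idx (f ⁻¹' {C}) := by
    intro C
    by_cases hC₂ : C = C₂
    · rwa [hC₂, hf₂]
    by_cases hC₁ : C = C₁
    · rw [hC₁]
      exact (hconn C₁).mono hG hidx (hLsurj C₁) hf₁
    · rw [hf₃ C hC₁ hC₂]
      exact hconn C
  have hfsurj : Function.Surjective f := by
    intro C
    by_cases hC₂ : C = C₂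
    · obtain ⟨i, hi⟩ := hJne
      exact ⟨i, by grind⟩
    · obtain ⟨i, hi⟩ := hLsurj C
      exact ⟨i, by grind⟩
  obtain ⟨F', hF'G, hF', hreach⟩ := exists_isAcyclic_of_indexConnected_fibers f hfconn
  let g : F'.ConnectedComponent → F.ConnectedComponent :=
    Quot.lift (fun v => f (idx v)) fun u v h => (hreach u v).1 h
  have hg : ∀ v, g (F'.connectedComponentMk v) = f (idx v) := fun _ => rfl
  have hginj : Function.Injective g := by
    intro C D h
    induction C using ConnectedComponent.ind with | _ u
    induction D using ConnectedComponent.ind with | _ v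
    exact ConnectedComponent.sound ((hreach u v).2 h)
  have hgsurj : Function.Surjective g := fun C => by
    obtain ⟨i, rfl⟩ := hfsurj C
    obtain ⟨v, rfl⟩ := hidx i
    exact ⟨F'.connectedComponentMk v, rfl⟩
  have hrank' : ∀ C, compRank T F' C = (f ⁻¹' {g C}).ncard := by
    intro C
    induction C using ConnectedComponent.ind with | _ v
    exact compRank_eq_ncard_fiber hT hidx hreach v
  refine ⟨F', ⟨hF'G, hF', ?_⟩, ?_, ?_⟩
  · intro i u hu v hv
    rw [hreach, (hT u i).1 hu, (hT v i).1 hv]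
  · have e₁ := hF'.ncard_edgeSet_add_card_connectedComponent
    have e₂ := hF.2.1.ncard_edgeSet_add_card_connectedComponent
    have e₃ := Nat.card_congr (Equiv.ofBijective g ⟨hginj, hgsurj⟩)
    lia
  · have hmem : C₂ ∈ {C | 3 < compRank T F C} := by
      rw [← hrank] at h₂
      exact h₂
    refine lt_of_le_of_lt ?_ (Set.ncard_sdiff_singleton_lt_of_mem hmem)
    refine Set.ncard_le_ncard_of_injOn g ?_ hginj.injOn
    intro C (hC : 3 < compRank T F' C)
    rw [hrank'] at hC
    have hgC₂ : g C ≠ C₂ := fun h => by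
      rw [h, hf₂] at hC
      lia
    refine ⟨?_, hgC₂⟩
    change 3 < compRank T F (g C)
    rw [hrank]
    by_cases hgC₁ : g C = C₁
    · rwa [hgC₁]
    · rwa [hf₃ _ hgC₁ hgC₂] at hC

end SteinerForest

/-- For a pairwise `1/2`-dense instance of Steiner forest without Steiner
nodes (the disjoint nonempty terminal sets cover `V(G)`, and every vertex of `T i` has at
least `|T j|/2` neighbours in every other `T j`), if some Steiner forest exists then there
is a minimum Steiner forest with at most one connected component of rank greater than 3. -/
theorem half_dense_steiner_forest_one_high_rank {V : Type*} [Fintype V] [DecidableEq V]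
    (G : SimpleGraph V) [DecidableRel G.Adj]
    {k : ℕ} (hk : 1 ≤ k) (T : Fin k → Finset V)
    (hdisj : ∀ i j, i ≠ j → Disjoint (T i) (T j))
    (hne : ∀ i, (T i).Nonempty)
    (hcover : Finset.univ.biUnion T = (Finset.univ : Finset V))
    (hdense : ∀ i j, i ≠ j → ∀ v ∈ T i,
      ((T j).card : ℝ) / 2 ≤ (((T j).filter (fun w => G.Adj v w)).card : ℝ))
    (hex : ∃ F, IsSteinerForest G T F) :
    ∃ F : SimpleGraph V, IsSteinerForest G T F ∧
      (∀ F' : SimpleGraph V, IsSteinerForest G T F' → F.edgeSet.ncard ≤ F'.edgeSet.ncard) ∧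
      {C : F.ConnectedComponent | 3 < compRank T F C}.Subsingleton := by
  choose idx hmem using fun v => by
    simpa using (Finset.ext_iff.1 hcover v).2 (Finset.mem_univ v)
  have hT : ∀ v i, v ∈ T i ↔ idx v = i := fun v i =>
    ⟨fun hv => by_contra fun h => Finset.disjoint_left.1 (hdisj _ _ h) (hmem v) hv,
      fun h => h ▸ hmem v⟩
  have hidx : Function.Surjective idx := fun i => (hne i).imp fun v hv => (hT v i).1 hv
  have hG : G.HalfDense idx := by
    intro v j hvj
    have h := hdense (idx v) j hvj v (hmem v)
    have h1 : {w | idx w = j} = (T j : Set V) := by ext w; simp [hT]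
    have h2 : {w | idx w = j ∧ G.Adj v w} = ((T j).filter fun w => G.Adj v w : Finset V) := by
      ext w; simp [hT]
    rw [h1, h2, Set.ncard_coe_finset, Set.ncard_coe_finset]
    rw [div_le_iff₀ two_pos, mul_comm] at h
    exact_mod_cast h
  obtain ⟨F₀, hF₀, hmin₀⟩ := Set.exists_min_image {F | IsSteinerForest G T F}
    (fun F => F.edgeSet.ncard) (Set.toFinite _) hex
  obtain ⟨F, ⟨hF, hFmin⟩, hmin⟩ := Set.exists_min_image
    {F | IsSteinerForest G T F ∧
      ∀ F', IsSteinerForest G T F' → F.edgeSet.ncard ≤ F'.edgeSet.ncard}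
    (fun F => {C | 3 < compRank T F C}.ncard) (Set.toFinite _) ⟨F₀, hF₀, hmin₀⟩
  refine ⟨F, hF, hFmin, fun C₁ h₁ C₂ h₂ => by_contra fun hC => ?_⟩
  obtain ⟨F', hF', hedges, hlt⟩ := hF.exists_fewer_high_rank hG hT hidx hC h₁ h₂
  exact (hmin F' ⟨hF', hedges ▸ hFmin⟩).not_gt hlt
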